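/- arXiv:math/0601773 — 5 statements merged into one kernel-verified Lean document; each statement's English description precedes it below -/
import Mathlib

section
/- Let F be holomorphic on an open set U ⊆ ℂ, let S(z,ẑ) = z·ẑ − ẑ³/3, and let Φ̌(z,ξ) be holomorphic on an open set V ⊆ ℂ². Define W = {(z,ẑ) ∈ U × ℂ : (z, S(z,ẑ)) ∈ V} and Ψ̃(z,ẑ) := Φ̌(z, S(z,ẑ)) on W. If Φ̌ satisfies ∂²Φ̌/∂z² − z·∂²Φ̌/∂ξ² = F(z)·Φ̌ on V, then Ψ̃ satisfies ∂²Ψ̃/∂z² − (2ẑ/(z − ẑ²))·∂²Ψ̃/∂z∂ẑ − (1/(z − ẑ²))·∂²Ψ̃/∂ẑ² = F(z)·Ψ̃ at every point of W with z ≠ ẑ². In fact, at every point of W one has the identity ∂²Ψ̃/∂z² evaluated via the chain rule reduces so that (∂²Φ̌/∂z² − z·∂²Φ̌/∂ξ²)(z, S(z,ẑ)) = ∂²Ψ̃/∂z²(z,ẑ) − (2ẑ/(z−ẑ²))·∂²Ψ̃/∂z∂ẑ(z,ẑ) − (1/(z−ẑ²))·∂²Ψ̃/∂ẑ²(z,ẑ)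 wherever z ≠ ẑ². -/
open Complex Metric

/-- The Airy major operator `Φ̌_zz − z Φ̌_ξξ` applied to `Φ̌(z,ξ)`. -/
noncomputable def majorOp (Φ : ℂ → ℂ → ℂ) (z ξ : ℂ) : ℂ :=
  deriv (deriv (fun w => Φ w ξ)) z - z * deriv (deriv (Φ z)) ξ

/-- The left-hand side of the linear PDE
`Ψ̃_zz − (2ẑ/(z−ẑ²)) Ψ̃_zẑ − (1/(z−ẑ²)) Ψ̃_ẑẑ`; `zh` stands for `ẑ`. -/
noncomputable def pdeLHS (Ψ : ℂ → ℂ → ℂ) (z zh : ℂ) : ℂ :=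
  deriv (deriv (fun w => Ψ w zh)) z
    - (2*zh/(z - zh^2)) * deriv (fun w => deriv (Ψ w) zh) z
    - (1/(z - zh^2)) * deriv (deriv (Ψ z)) zh

open MeasureTheory in
/-- Directional derivatives of a holomorphic function of several variables are holomorphic. -/
lemma differentiableAt_fderiv_apply_aux (f : ℂ × ℂ → ℂ) (V : Set (ℂ × ℂ)) (hV : IsOpen V)
    (hf : DifferentiableOn ℂ f V) (v p₀ : ℂ × ℂ) (hp : p₀ ∈ V) :
    DifferentiableAt ℂ (fun p => fderiv ℂ f p v) p₀ := by
  have hdV : ∀ p ∈ V, DifferentiableAt ℂ f p := fun p h => hf.differentiableAt (hV.mem_nhds h)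
  obtain ⟨R, hR, hball⟩ : ∃ R > 0, ∀ p ∈ ball p₀ R, p ∈ V ∧ dist (f p) (f p₀) < 1 := by
    have h1 : ∀ᶠ p in nhds p₀, p ∈ V ∧ dist (f p) (f p₀) < 1 :=
      (hV.eventually_mem hp).and
        ((hdV p₀ hp).continuousAt.eventually (ball_mem_nhds _ one_pos))
    obtain ⟨R, hR, h⟩ := Metric.eventually_nhds_iff_ball.1 h1
    exact ⟨R, hR, h⟩
  obtain ⟨r, hr, rfl⟩ : ∃ r > 0, R = 4 * r := ⟨R / 4, by positivity, by ring⟩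
  have hbound : ∀ q ∈ ball p₀ (2 * r), ‖fderiv ℂ f q‖ ≤ 2 / (2 * r) := by
    intro q hq
    have hsub : ball q (2 * r) ⊆ ball p₀ (4 * r) := by
      apply ball_subset_ball'
      have := mem_ball.1 hq
      linarith
    apply norm_fderiv_le_div_of_mapsTo_ball
    · intro x hx
      exact (hdV x (hball x (hsub hx)).1).differentiableWithinAt
    · intro x hx
      have h1 := (hball x (hsub hx)).2
      have h2 := (hball q (hsub (mem_ball_self (by positivity)))).2
      have := dist_triangle_right (f x) (f q) (f p₀)
      rw [mem_closedBall]
      linarith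
    · positivity
  set ρ : ℝ := r / (‖v‖ + 1) with hρ
  have hρ0 : 0 < ρ := by positivity
  have hρv : ρ * ‖v‖ < r := by
    rw [hρ, div_mul_eq_mul_div, div_lt_iff₀ (by positivity)]
    nlinarith [norm_nonneg v]
  have hin : ∀ x ∈ ball p₀ r, ∀ t : ℂ, ‖t‖ ≤ ρ → x + t • v ∈ ball p₀ (2 * r) := by
    intro x hx t ht
    have h1 : ‖t • v‖ ≤ ρ * ‖v‖ := by rw [norm_smul]; gcongr
    rw [mem_ball, dist_eq_norm] at hx ⊢
    calc ‖x + t • v - p₀‖ = ‖(x - p₀) + t • v‖ := by congr 1; abel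
      _ ≤ ‖x - p₀‖ + ‖t • v‖ := norm_add_le _ _
      _ < 2 * r := by linarith
  have hinV : ∀ x ∈ ball p₀ r, ∀ t : ℂ, ‖t‖ ≤ ρ → x + t • v ∈ V := fun x hx t ht =>
    (hball _ (ball_subset_ball (by linarith) (hin x hx t ht))).1
  set c : ℝ → ℂ := circleMap 0 ρ with hc
  have hcn : ∀ θ, ‖c θ‖ ≤ ρ := by intro θ; simp [hc, abs_of_pos hρ0]
  have hcc : Continuous c := continuous_circleMap 0 ρ
  set g : ℝ → ℂ := fun θ => deriv c θ * (1 / (c θ - 0) ^ 2) with hg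
  have hgc : Continuous g := by
    have : ∀ θ, c θ ≠ 0 := fun θ => circleMap_ne_center hρ0.ne'
    have h2 : deriv c = fun θ => c θ * I := by
      funext θ; simp [hc]
    simp only [hg, h2]
    refine (hcc.mul continuous_const).mul (continuous_const.div (by fun_prop) ?_)
    intro θ; simpa using this θ
  have hcauchy : ∀ x ∈ ball p₀ r,
      (∫ θ in (0:ℝ)..2 * Real.pi, g θ * f (x + c θ • v)) =
        (2 * Real.pi * I) * fderiv ℂ f x v := by
    intro x hx
    have hd : DifferentiableOn ℂ (fun t : ℂ => f (x + t • v)) (closedBall 0 ρ) := by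
      intro t ht
      have ht' : ‖t‖ ≤ ρ := by simpa using ht
      have h1 := hdV _ (hinV x hx t ht')
      have h2 : DifferentiableAt ℂ (fun t : ℂ => x + t • v) t := by fun_prop
      exact (DifferentiableAt.comp t h1 h2).differentiableWithinAt
    have h := hd.deriv_eq_smul_circleIntegral hρ0
    have hder : deriv (fun t : ℂ => f (x + t • v)) 0 = fderiv ℂ f x v := by
      have h2 : HasDerivAt (fun t : ℂ => x + t • v) v 0 := by
        simpa using ((hasDerivAt_id (0:ℂ)).smul_const v).const_add x
      have h1 : HasFDerivAt f (fderiv ℂ f x) (x + (0:ℂ) • v) := by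
        have := (hdV _ (hinV x hx 0 (by simpa using hρ0.le))).hasFDerivAt
        simpa using this
      exact (h1.comp_hasDerivAt 0 h2).deriv
    rw [hder, circleIntegral] at h
    simp only [smul_eq_mul] at h
    rw [← h]
    congr 1
    funext θ
    simp only [hg, hc, mul_assoc]
  have key : HasFDerivAt (fun x => ∫ θ in (0:ℝ)..2 * Real.pi, g θ * f (x + c θ • v))
      (∫ θ in (0:ℝ)..2 * Real.pi, g θ • fderiv ℂ f (p₀ + c θ • v)) p₀ := by
    have hcont : ∀ x ∈ ball p₀ r, Continuous fun θ => g θ * f (x + c θ • v) := by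
      intro x hx
      refine hgc.mul (continuous_iff_continuousAt.2 fun θ => ?_)
      have h1 := (hdV _ (hinV x hx (c θ) (hcn θ))).continuousAt
      have h2 : ContinuousAt (fun θ => x + c θ • v) θ := by fun_prop
      exact ContinuousAt.comp (f := fun θ => x + c θ • v) h1 h2
    refine intervalIntegral.hasFDerivAt_integral_of_dominated_of_fderiv_le
      (F := fun x θ => g θ * f (x + c θ • v))
      (F' := fun x θ => g θ • fderiv ℂ f (x + c θ • v))
      (bound := fun θ => ‖g θ‖ * (2 / (2 * r)))
      (ball_mem_nhds p₀ hr) ?_ ?_ ?_ ?_ ?_ ?_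
    · filter_upwards [ball_mem_nhds p₀ hr] with x hx
      exact (hcont x hx).aestronglyMeasurable
    · exact (hcont p₀ (mem_ball_self hr)).intervalIntegrable _ _
    · have hm : Measurable (fun θ => fderiv ℂ f (p₀ + c θ • v)) :=
        (measurable_fderiv ℂ f).comp
          (by fun_prop : Continuous fun θ => p₀ + c θ • v).measurable
      exact hgc.aestronglyMeasurable.smul hm.aestronglyMeasurable
    · refine Filter.Eventually.of_forall fun θ _ x hx => ?_
      rw [norm_smul]
      gcongr
      exact hbound _ (hin x hx _ (hcn θ))
    · exact (by fun_prop : Continuous fun θ => ‖g θ‖ * (2 / (2 * r))).intervalIntegrable _ _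
    · refine Filter.Eventually.of_forall fun θ _ x hx => ?_
      have h1 := (hdV _ (hinV x hx (c θ) (hcn θ))).hasFDerivAt
      have h2 : HasFDerivAt (fun x => f (x + c θ • v)) (fderiv ℂ f (x + c θ • v)) x :=
        (hasFDerivAt_comp_add_right (c θ • v)).2 h1
      exact h2.const_mul (g θ)
  have h2 : DifferentiableAt ℂ (fun x => (2 * Real.pi * I)⁻¹ *
      ∫ θ in (0:ℝ)..2 * Real.pi, g θ * f (x + c θ • v)) p₀ :=
    key.differentiableAt.const_mul _
  refine h2.congr_of_eventuallyEq ?_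
  filter_upwards [ball_mem_nhds p₀ hr] with x hx
  rw [hcauchy x hx, inv_mul_cancel_left₀ two_pi_I_ne_zero]

lemma contDiffOn_two_aux (f : ℂ × ℂ → ℂ) (V : Set (ℂ × ℂ)) (hV : IsOpen V)
    (hf : DifferentiableOn ℂ f V) (n : ℕ) : ContDiffOn ℂ n f V := by
  induction n generalizing f with
  | zero => exact contDiffOn_zero.2 hf.continuousOn
  | succ n ih =>
    rw [Nat.cast_succ, contDiffOn_succ_iff_fderiv_apply hV.uniqueDiffOn]
    refine ⟨hf, by simp, fun y => ?_⟩
    have h := ih (fun p => fderiv ℂ f p y) fun p hp =>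
      (differentiableAt_fderiv_apply_aux f V hV hf y p hp).differentiableWithinAt
    refine h.congr fun p hp => ?_
    rw [fderivWithin_of_isOpen hV hp]

/-- Chain rule in two variables. -/
lemma chain_aux (G : ℂ × ℂ → ℂ) (a s : ℂ → ℂ) (a' s' t : ℂ)
    (hG : DifferentiableAt ℂ G (a t, s t)) (ha : HasDerivAt a a' t) (hs : HasDerivAt s s' t) :
    HasDerivAt (fun u => G (a u, s u))
      (a' * fderiv ℂ G (a t, s t) (1, 0) + s' * fderiv ℂ G (a t, s t) (0, 1)) t := by
  have h := hG.hasFDerivAt.comp_hasDerivAt t (ha.prodMk hs)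
  refine h.congr_deriv ?_
  have : ((a', s') : ℂ × ℂ) = a' • (1, 0) + s' • (0, 1) := by ext <;> simp
  rw [this, map_add, map_smul, map_smul]
  simp

lemma main_aux (V : Set (ℂ × ℂ)) (hV : IsOpen V) (Φ : ℂ → ℂ → ℂ)
    (hΦ : DifferentiableOn ℂ (fun p : ℂ × ℂ => Φ p.1 p.2) V) (z zh : ℂ)
    (hz : (z, z*zh - zh^3/3) ∈ V) (hne : z ≠ zh^2) :
    majorOp Φ z (z*zh - zh^3/3) = pdeLHS (fun a b => Φ a (a*b - b^3/3)) z zh := by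
  set f : ℂ × ℂ → ℂ := fun p => Φ p.1 p.2 with hf
  set A : ℂ × ℂ → ℂ := fun p => fderiv ℂ f p (1, 0) with hA
  set B : ℂ × ℂ → ℂ := fun p => fderiv ℂ f p (0, 1) with hB
  have df : ∀ p ∈ V, DifferentiableAt ℂ f p := fun p h => hΦ.differentiableAt (hV.mem_nhds h)
  have dA : ∀ p ∈ V, DifferentiableAt ℂ A p := fun p h =>
    differentiableAt_fderiv_apply_aux f V hV hΦ (1, 0) p h
  have dB : ∀ p ∈ V, DifferentiableAt ℂ B p := fun p h =>
    differentiableAt_fderiv_apply_aux f V hV hΦ (0, 1) p h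
  set p : ℂ × ℂ := (z, z*zh - zh^3/3) with hp
  have hC2 : ContDiffAt ℂ 2 f p :=
    (contDiffOn_two_aux f V hV hΦ 2).contDiffAt (hV.mem_nhds hz)
  have hsymm : fderiv ℂ A p (0, 1) = fderiv ℂ B p (1, 0) := by
    have h1 : IsSymmSndFDerivAt ℂ f p := hC2.isSymmSndFDerivAt (by simp)
    have hd : DifferentiableAt ℂ (fderiv ℂ f) p :=
      (hC2.fderiv_right (m := 1) (by norm_num)).differentiableAt (by norm_num)
    have e : ∀ v w, fderiv ℂ (fun q => fderiv ℂ f q v) p w = fderiv ℂ (fderiv ℂ f) p w v := by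
      intro v w
      rw [fderiv_clm_apply hd (differentiableAt_const v)]
      simp
    rw [hA, hB, e, e]
    exact h1 _ _
  -- derivatives of the substitution
  have s1 : ∀ a b : ℂ, HasDerivAt (fun a : ℂ => a*b - b^3/3) b a := fun a b => by
    simpa using ((hasDerivAt_id a).mul_const b).sub_const (b^3/3)
  have s2 : ∀ a b : ℂ, HasDerivAt (fun b : ℂ => a*b - b^3/3) (a - b^2) b := fun a b => by
    have h := ((hasDerivAt_id b).const_mul a).sub (((hasDerivAt_id b).pow 3).div_const 3)
    refine h.congr_deriv ?_
    simp
  -- openness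
  have o1 : ∀ᶠ w in nhds z, (w, z*zh - zh^3/3) ∈ V :=
    (by fun_prop : Continuous fun w : ℂ => (w, z*zh - zh^3/3)).continuousAt.eventually
      (hV.mem_nhds hz)
  have o2 : ∀ᶠ x in nhds (z*zh - zh^3/3), (z, x) ∈ V :=
    (by fun_prop : Continuous fun x : ℂ => (z, x)).continuousAt.eventually
      (hV.mem_nhds hz)
  have o3 : ∀ᶠ w in nhds z, (w, w*zh - zh^3/3) ∈ V :=
    (by fun_prop : Continuous fun w : ℂ => (w, w*zh - zh^3/3)).continuousAt.eventually
      (hV.mem_nhds hz)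
  have o4 : ∀ᶠ b in nhds zh, (z, z*b - b^3/3) ∈ V :=
    (by fun_prop : Continuous fun b : ℂ => (z, z*b - b^3/3)).continuousAt.eventually
      (hV.mem_nhds hz)
  have e1 : deriv (deriv (fun w => Φ w (z*zh - zh^3/3))) z = fderiv ℂ A p (1, 0) := by
    have h : deriv (fun w => Φ w (z*zh - zh^3/3)) =ᶠ[nhds z] fun w => A (w, z*zh - zh^3/3) := by
      filter_upwards [o1] with w hw
      simpa using (chain_aux f (fun w => w) (fun _ => z*zh - zh^3/3) 1 0 w (df _ hw)
        (hasDerivAt_id w) (hasDerivAt_const _ _)).deriv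
    rw [h.deriv_eq]
    simpa using (chain_aux A (fun w => w) (fun _ => z*zh - zh^3/3) 1 0 z (dA _ hz)
        (hasDerivAt_id z) (hasDerivAt_const _ _)).deriv
  have e2 : deriv (deriv (Φ z)) (z*zh - zh^3/3) = fderiv ℂ B p (0, 1) := by
    have h : deriv (Φ z) =ᶠ[nhds (z*zh - zh^3/3)] fun x => B (z, x) := by
      filter_upwards [o2] with w hw
      simpa using (chain_aux f (fun _ => z) (fun w => w) 0 1 w (df _ hw)
        (hasDerivAt_const _ _) (hasDerivAt_id w)).deriv
    rw [h.deriv_eq]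
    simpa using (chain_aux B (fun _ => z) (fun w => w) 0 1 (z*zh - zh^3/3) (dB _ hz)
        (hasDerivAt_const _ _) (hasDerivAt_id _)).deriv
  have e3 : deriv (deriv (fun w => Φ w (w*zh - zh^3/3))) z =
      (fderiv ℂ A p (1, 0) + zh * fderiv ℂ A p (0, 1))
        + zh * (fderiv ℂ B p (1, 0) + zh * fderiv ℂ B p (0, 1)) := by
    have h : deriv (fun w => Φ w (w*zh - zh^3/3)) =ᶠ[nhds z]
        fun w => A (w, w*zh - zh^3/3) + zh * B (w, w*zh - zh^3/3) := by
      filter_upwards [o3] with w hw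
      simpa using (chain_aux f (fun w => w) (fun w => w*zh - zh^3/3) 1 zh w (df _ hw)
        (hasDerivAt_id w) (s1 w zh)).deriv
    rw [h.deriv_eq]
    have hA' := chain_aux A (fun w => w) (fun w => w*zh - zh^3/3) 1 zh z (dA _ hz)
        (hasDerivAt_id z) (s1 z zh)
    have hB' := chain_aux B (fun w => w) (fun w => w*zh - zh^3/3) 1 zh z (dB _ hz)
        (hasDerivAt_id z) (s1 z zh)
    simpa using (hA'.fun_add (hB'.const_mul zh)).deriv
  have e4 : deriv (fun w => deriv (fun b => Φ w (w*b - b^3/3)) zh) z =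
      B p + (z - zh^2) * (fderiv ℂ B p (1, 0) + zh * fderiv ℂ B p (0, 1)) := by
    have h : (fun w => deriv (fun b => Φ w (w*b - b^3/3)) zh) =ᶠ[nhds z]
        fun w => (w - zh^2) * B (w, w*zh - zh^3/3) := by
      filter_upwards [o3] with w hw
      simpa using (chain_aux f (fun _ => w) (fun b => w*b - b^3/3) 0 (w - zh^2) zh (df _ hw)
        (hasDerivAt_const _ _) (s2 w zh)).deriv
    rw [h.deriv_eq]
    have hB' := chain_aux B (fun w => w) (fun w => w*zh - zh^3/3) 1 zh z (dB _ hz)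
        (hasDerivAt_id z) (s1 z zh)
    simpa using (((hasDerivAt_id z).sub_const (zh^2)).fun_mul hB').deriv
  have e5 : deriv (deriv (fun b => Φ z (z*b - b^3/3))) zh =
      -(2 * zh) * B p + (z - zh^2) * ((z - zh^2) * fderiv ℂ B p (0, 1)) := by
    have h : deriv (fun b => Φ z (z*b - b^3/3)) =ᶠ[nhds zh]
        fun b => (z - b^2) * B (z, z*b - b^3/3) := by
      filter_upwards [o4] with b hb
      simpa using (chain_aux f (fun _ => z) (fun b => z*b - b^3/3) 0 (z - b^2) b (df _ hb)
        (hasDerivAt_const _ _) (s2 z b)).deriv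
    rw [h.deriv_eq]
    have hB' := chain_aux B (fun _ => z) (fun b => z*b - b^3/3) 0 (z - zh^2) zh (dB _ hz)
        (hasDerivAt_const _ _) (s2 z zh)
    simpa using ((((hasDerivAt_id zh).pow 2).const_sub z).fun_mul hB').deriv
  have hD : z - zh^2 ≠ 0 := sub_ne_zero.2 hne
  unfold majorOp pdeLHS
  simp only [e1, e2, e3, e4, e5, hsymm]
  field_simp
  ring

/-- Under the substitution `ξ = S(z,ẑ) = zẑ − ẑ³/3`, `Ψ̃(z,ẑ) := Φ̌(z,S(z,ẑ))`, the major
equation `Φ̌_zz − z Φ̌_ξξ = F Φ̌` becomes the linear PDE for `Ψ̃` away from `z = ẑ²`;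
in fact the chain rule gives `(Φ̌_zz − z Φ̌_ξξ)(z,S(z,ẑ)) = pdeLHS Ψ̃ (z,ẑ)` there. -/
theorem major_equation_substitution (U : Set ℂ) (hU : IsOpen U)
    (F : ℂ → ℂ) (hF : DifferentiableOn ℂ F U)
    (V : Set (ℂ × ℂ)) (hV : IsOpen V)
    (Φ : ℂ → ℂ → ℂ)
    (hΦ : DifferentiableOn ℂ (fun p : ℂ × ℂ => Φ p.1 p.2) V) :
    ((∀ p ∈ V, majorOp Φ p.1 p.2 = F p.1 * Φ p.1 p.2) →
      ∀ z zh : ℂ, z ∈ U → (z, z*zh - zh^3/3) ∈ V → z ≠ zh^2 →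
        pdeLHS (fun a b => Φ a (a*b - b^3/3)) z zh = F z * Φ z (z*zh - zh^3/3)) ∧
    (∀ z zh : ℂ, z ∈ U → (z, z*zh - zh^3/3) ∈ V → z ≠ zh^2 →
      majorOp Φ z (z*zh - zh^3/3) = pdeLHS (fun a b => Φ a (a*b - b^3/3)) z zh) := by
  have key : ∀ z zh : ℂ, z ∈ U → (z, z*zh - zh^3/3) ∈ V → z ≠ zh^2 →
      majorOp Φ z (z*zh - zh^3/3) = pdeLHS (fun a b => Φ a (a*b - b^3/3)) z zh :=
    fun z zh _ hz hne => main_aux V hV Φ hΦ z zh hz hne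
  refine ⟨fun h z zh hzU hz hne => ?_, key⟩
  rw [← key z zh hzU hz hne]
  exact h _ hz
end

section
/- Let λ ∈ ℂ and let F(z) = λ² (constant). Then for each choice of sign the function Ψ̃(z,ẑ) = e^{±λ(z − ẑ²)}/(z − ẑ²) satisfies, at every point (z,ẑ) ∈ ℂ² with z ≠ ẑ², the linear PDE ∂²Ψ̃/∂z² − (2ẑ/(z − ẑ²))·∂²Ψ̃/∂z∂ẑ − (1/(z − ẑ²))·∂²Ψ̃/∂ẑ² = F(z)·Ψ̃. -/
open Complex Metric

/-- For constant potential `F(z) = λ²`, for either sign `σ = ±1`, the function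
`Ψ̃(z,ẑ) = e^{σλ(z−ẑ²)}/(z−ẑ²)` solves the linear PDE away from `z = ẑ²`. -/
theorem constant_potential_explicit_solution (lam σ : ℂ) (hσ : σ = 1 ∨ σ = -1) :
    ∀ z zh : ℂ, z ≠ zh^2 →
      pdeLHS (fun a b => Complex.exp (σ * lam * (a - b^2)) / (a - b^2)) z zh
        = lam^2 * (Complex.exp (σ * lam * (z - zh^2)) / (z - zh^2)) := by
  intro z zh hz
  have hs : z - zh^2 ≠ 0 := sub_ne_zero.mpr hz
  have hc : (σ * lam)^2 = lam^2 := by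
    rcases hσ with h | h <;> subst h <;> ring
  rw [← hc]
  generalize σ * lam = c
  have g1 : ∀ s : ℂ, s ≠ 0 → HasDerivAt (fun s => Complex.exp (c * s) / s)
      (Complex.exp (c * s) * (c / s - 1 / s^2)) s := by
    intro s h
    have h1 := (((hasDerivAt_id s).const_mul c).cexp).div (hasDerivAt_id s) h
    refine h1.congr_deriv ?_
    simp only [id]
    field_simp
  have g2 : ∀ s : ℂ, s ≠ 0 → HasDerivAt (fun s => Complex.exp (c * s) * (c / s - 1 / s^2))
      (Complex.exp (c * s) * (c^2 / s - 2 * c / s^2 + 2 / s^3)) s := by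
    intro s h
    have h1 := (((hasDerivAt_id s).const_mul c).cexp).mul
      (((hasDerivAt_const s c).div (hasDerivAt_id s) h).sub
        ((hasDerivAt_const s (1:ℂ)).div ((hasDerivAt_id s).pow 2) (pow_ne_zero 2 h)))
    refine h1.congr_deriv ?_
    simp [id]
    field_simp
    ring
  have sz : ∀ a b : ℂ, HasDerivAt (fun w : ℂ => w - b^2) 1 a := fun a b =>
    (hasDerivAt_id a).sub_const _
  have sb : ∀ a b : ℂ, HasDerivAt (fun w : ℂ => a - w^2) (-(2*b)) b := fun a b => by
    simpa using ((hasDerivAt_id b).pow 2).const_sub a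
  have ez : ∀ᶠ w in nhds z, w - zh^2 ≠ 0 :=
    (sz z zh).continuousAt.eventually_ne hs
  have eb : ∀ᶠ w in nhds zh, z - w^2 ≠ 0 :=
    (sb z zh).continuousAt.eventually_ne hs
  have D1 : deriv (deriv (fun w => Complex.exp (c * (w - zh^2)) / (w - zh^2))) z
      = Complex.exp (c * (z - zh^2)) *
        (c^2 / (z - zh^2) - 2 * c / (z - zh^2)^2 + 2 / (z - zh^2)^3) := by
    have e : deriv (fun w => Complex.exp (c * (w - zh^2)) / (w - zh^2)) =ᶠ[nhds z]
        fun w => Complex.exp (c * (w - zh^2)) * (c / (w - zh^2) - 1 / (w - zh^2)^2) := by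
      filter_upwards [ez] with w hw
      have := ((g1 _ hw).comp w (sz w zh)).deriv
      rw [mul_one] at this
      exact this
    rw [e.deriv_eq]
    have := ((g2 _ hs).comp z (sz z zh)).deriv
    rw [mul_one] at this
    exact this
  have D2 : deriv (fun w => deriv (fun b => Complex.exp (c * (w - b^2)) / (w - b^2)) zh) z
      = Complex.exp (c * (z - zh^2)) *
        (c^2 / (z - zh^2) - 2 * c / (z - zh^2)^2 + 2 / (z - zh^2)^3) * (-(2*zh)) := by
    have e : (fun w => deriv (fun b => Complex.exp (c * (w - b^2)) / (w - b^2)) zh) =ᶠ[nhds z]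
        fun w => Complex.exp (c * (w - zh^2)) * (c / (w - zh^2) - 1 / (w - zh^2)^2)
          * (-(2*zh)) := by
      filter_upwards [ez] with w hw
      exact ((g1 _ hw).comp zh (sb w zh)).deriv
    rw [e.deriv_eq]
    have := (((g2 _ hs).comp z (sz z zh)).mul_const (-(2*zh))).deriv
    rw [mul_one] at this
    exact this
  have D3 : deriv (deriv (fun b => Complex.exp (c * (z - b^2)) / (z - b^2))) zh
      = Complex.exp (c * (z - zh^2)) *
        (c^2 / (z - zh^2) - 2 * c / (z - zh^2)^2 + 2 / (z - zh^2)^3) * (-(2*zh)) * (-(2*zh))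
        + Complex.exp (c * (z - zh^2)) * (c / (z - zh^2) - 1 / (z - zh^2)^2) * (-2) := by
    have e : deriv (fun b => Complex.exp (c * (z - b^2)) / (z - b^2)) =ᶠ[nhds zh]
        fun b => Complex.exp (c * (z - b^2)) * (c / (z - b^2) - 1 / (z - b^2)^2)
          * (-(2*b)) := by
      filter_upwards [eb] with w hw
      exact ((g1 _ hw).comp w (sb z w)).deriv
    rw [e.deriv_eq]
    have hl : HasDerivAt (fun b : ℂ => -(2*b)) (-2) zh := by
      exact (((hasDerivAt_id zh).const_mul (2:ℂ)).neg).congr_deriv (by simp)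
    exact (((g2 _ hs).comp zh (sb z zh)).mul hl).deriv
  unfold pdeLHS
  simp only []
  rw [D1, D2, D3]
  generalize Complex.exp (c * (z - zh^2)) = E
  generalize z - zh^2 = s at hs
  field_simp
  ring
end

section
/- Let λ ∈ ℂ and let F(z) = λ²·z. Define G : ℂ² → ℂ by the everywhere-convergent series G(z,ẑ) = Σ_{k≥0} (λ/3)^{2k} · (z − ẑ²)^{2k} · (4z − ẑ²)^k / (2k)! (that is, G(z,ẑ) = cosh( (λ/3)(z − ẑ²)·√(4z − ẑ²) ), which is well defined since cosh is even). Then G is an entire function on ℂ², and the function Ψ̃(z,ẑ) := G(z,ẑ)/(z − ẑ²) satisfies, at every point (z,ẑ) ∈ ℂ² with z ≠ ẑ², the linear PDE ∂²Ψ̃/∂z² − (2ẑ/(z − ẑ²))·∂²Ψ̃/∂z∂ẑ − (1/(z − ẑ²))·∂²Ψ̃/∂ẑ² = F(z)·Ψ̃. -/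
open Complex Metric

/-- The entire function `C(w) = Σ w^k/(2k)!`, so that `C(x²) = cosh x`. -/
noncomputable def coshSq (w : ℂ) : ℂ := ∑' k : ℕ, w^k / ((2*k).factorial : ℂ)

lemma coshSq_bound (R : ℝ) (k : ℕ) (w : ℂ) (hw : ‖w‖ ≤ R) :
    ‖w^k / ((2*k).factorial : ℂ)‖ ≤ R^k / (k.factorial : ℝ) := by
  rw [norm_div, norm_pow, Complex.norm_natCast]
  have h0 : 0 ≤ R := le_trans (norm_nonneg _) hw
  have h1 : (k.factorial : ℝ) ≤ ((2*k).factorial : ℝ) := by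
    exact_mod_cast Nat.factorial_le (by omega)
  have h2 : (0:ℝ) < (k.factorial : ℝ) := by exact_mod_cast Nat.factorial_pos k
  gcongr

lemma coshSq_summable (w : ℂ) : Summable (fun k : ℕ => w^k / ((2*k).factorial : ℂ)) :=
  Summable.of_norm_bounded (Real.summable_pow_div_factorial ‖w‖)
    (fun k => coshSq_bound _ k w le_rfl)

lemma coshSq_differentiable : Differentiable ℂ coshSq := by
  intro w
  have h : DifferentiableOn ℂ coshSq (Metric.ball 0 (‖w‖ + 1)) := by
    refine Complex.differentiableOn_tsum_of_summable_norm
      (Real.summable_pow_div_factorial (‖w‖ + 1)) ?_ Metric.isOpen_ball ?_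
    · intro k
      fun_prop
    · intro k x hx
      exact coshSq_bound _ k x (by simpa using (mem_ball_zero_iff.mp hx).le)
  exact h.differentiableAt (Metric.isOpen_ball.mem_nhds (by simp))

lemma coshSq_sq (x : ℂ) : coshSq (x^2) = Complex.cosh x := by
  rw [← (Complex.hasSum_cosh x).tsum_eq]
  simp only [coshSq, ← pow_mul]

lemma coshSq_ode (w : ℂ) :
    coshSq w = 4 * w * deriv (deriv coshSq) w + 2 * deriv coshSq w := by
  obtain ⟨x, rfl⟩ : ∃ x : ℂ, w = x^2 := by
    obtain ⟨x, hx⟩ := IsAlgClosed.exists_pow_nat_eq w (n := 2) (by norm_num)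
    exact ⟨x, hx.symm⟩
  have hC : ∀ y, HasDerivAt coshSq (deriv coshSq y) y :=
    fun y => (coshSq_differentiable y).hasDerivAt
  have hD : ∀ y, HasDerivAt (deriv coshSq) (deriv (deriv coshSq) y) y :=
    fun y => (coshSq_differentiable.deriv y).hasDerivAt
  have hsq : ∀ y : ℂ, HasDerivAt (fun t : ℂ => t^2) (2*y) y := by
    intro y
    simpa using hasDerivAt_pow 2 y
  have e0 : (fun t : ℂ => coshSq (t^2)) = Complex.cosh := funext coshSq_sq
  have e1 : (fun t : ℂ => deriv coshSq (t^2) * (2*t)) = Complex.sinh := by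
    funext y
    have h1 := (hC (y^2)).comp y (hsq y)
    have h2 := Complex.hasDerivAt_cosh y
    rw [← e0] at h2
    exact h1.unique h2
  have h1 := ((hD (x^2)).comp x (hsq x)).mul ((hasDerivAt_id x).const_mul 2)
  have h2 := Complex.hasDerivAt_sinh x
  rw [← e1] at h2
  have h3 := h1.unique h2
  rw [coshSq_sq, ← h3]
  simp only [Function.comp, id]
  ring

lemma pde_coshSq (κ z h : ℂ) (hz : z ≠ h^2) :
    pdeLHS (fun a b => coshSq (κ * (a - b^2)^2 * (4*a - b^2)) / (a - b^2)) z h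
      = 9 * κ * z * (coshSq (κ * (z - h^2)^2 * (4*z - h^2)) / (z - h^2)) := by
  have hC : ∀ y, HasDerivAt coshSq (deriv coshSq y) y :=
    fun y => (coshSq_differentiable y).hasDerivAt
  have hD : ∀ y, HasDerivAt (deriv coshSq) (deriv (deriv coshSq) y) y :=
    fun y => (coshSq_differentiable.deriv y).hasDerivAt
  have ode := coshSq_ode
  generalize deriv (deriv coshSq) = E at *
  generalize deriv coshSq = D at *
  generalize coshSq = C at *
  have ua : ∀ a b : ℂ, HasDerivAt (fun a : ℂ => a - b^2) 1 a := fun a b =>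
    (hasDerivAt_id a).sub_const _
  have ub : ∀ a b : ℂ, HasDerivAt (fun b : ℂ => a - b^2) (-(2*b)) b := fun a b => by
    simpa using (hasDerivAt_pow 2 b).const_sub a
  have va : ∀ a b : ℂ, HasDerivAt (fun a : ℂ => 4*a - b^2) 4 a := fun a b => by
    simpa using ((hasDerivAt_id a).const_mul 4).sub_const (b^2)
  have vb : ∀ a b : ℂ, HasDerivAt (fun b : ℂ => 4*a - b^2) (-(2*b)) b := fun a b => by
    simpa using (hasDerivAt_pow 2 b).const_sub (4*a)
  have wa : ∀ a b : ℂ, HasDerivAt (fun a : ℂ => κ * (a - b^2)^2 * (4*a - b^2))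
      (κ * (2*(a - b^2)*(4*a-b^2) + 4*(a-b^2)^2)) a := fun a b => by
    refine ((((ua a b).pow 2).const_mul κ).mul (va a b)).congr_deriv ?_
    simp only [Pi.pow_apply]; push_cast; ring
  have wb : ∀ a b : ℂ, HasDerivAt (fun b : ℂ => κ * (a - b^2)^2 * (4*a - b^2))
      (κ * (-4*b*(a - b^2)*(4*a-b^2) - 2*b*(a-b^2)^2)) b := fun a b => by
    refine ((((ub a b).pow 2).const_mul κ).mul (vb a b)).congr_deriv ?_
    simp only [Pi.pow_apply]; push_cast; ring
  have Ca := fun a b => (hC _).comp a (wa a b)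
  have Cb := fun a b => (hC _).comp b (wb a b)
  have Da := fun a b => (hD _).comp a (wa a b)
  have Db := fun a b => (hD _).comp b (wb a b)
  have Pa : ∀ a b : ℂ, a - b^2 ≠ 0 →
      HasDerivAt (fun a => C (κ * (a - b^2)^2 * (4*a - b^2)) / (a - b^2))
      (D (κ * (a - b^2)^2 * (4*a - b^2)) * (κ * (2*(4*a-b^2) + 4*(a-b^2)))
        - C (κ * (a - b^2)^2 * (4*a - b^2)) / (a-b^2)^2) a := fun a b hu => by
    refine ((Ca a b).div (ua a b) hu).congr_deriv ?_
    simp only [Function.comp]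
    field_simp
  have Pb : ∀ a b : ℂ, a - b^2 ≠ 0 →
      HasDerivAt (fun b => C (κ * (a - b^2)^2 * (4*a - b^2)) / (a - b^2))
      (D (κ * (a - b^2)^2 * (4*a - b^2)) * (κ * (-4*b*(4*a-b^2) - 2*b*(a-b^2)))
        + 2*b*C (κ * (a - b^2)^2 * (4*a - b^2)) / (a-b^2)^2) b := fun a b hu => by
    refine ((Cb a b).div (ub a b) hu).congr_deriv ?_
    simp only [Function.comp]
    field_simp
    ring
  have hu : z - h^2 ≠ 0 := sub_ne_zero.mpr hz
  have hu2 : (z - h^2)^2 ≠ 0 := pow_ne_zero 2 hu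
  have ea : ∀ᶠ a in nhds z, a - h^2 ≠ 0 :=
    (ua z h).continuousAt.eventually_ne hu
  have eb : ∀ᶠ b in nhds h, z - b^2 ≠ 0 :=
    (ub z h).continuousAt.eventually_ne hu
  have Paa := ((Da z h).mul ((((va z h).const_mul 2).add ((ua z h).const_mul 4)).const_mul κ)).sub
    ((Ca z h).div ((ua z h).pow 2) hu2)
  have Pba := ((Da z h).mul ((((va z h).const_mul (-4*h)).sub
      ((ua z h).const_mul (2*h))).const_mul κ)).add
    (((Ca z h).const_mul (2*h)).div ((ua z h).pow 2) hu2)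
  have Pbb := ((Db z h).mul (((((hasDerivAt_id h).const_mul (-4)).mul (vb z h)).sub
      (((hasDerivAt_id h).const_mul 2).mul (ub z h))).const_mul κ)).add
    ((((hasDerivAt_id h).const_mul 2).mul (Cb z h)).div ((ub z h).pow 2) hu2)
  have Qaa := Paa.congr_of_eventuallyEq
    (f₁ := deriv (fun a => C (κ * (a - h^2)^2 * (4*a - h^2)) / (a - h^2)))
    (ea.mono fun a ha => (Pa a h ha).deriv)
  have Qba := Pba.congr_of_eventuallyEq
    (f₁ := fun a => deriv (fun b => C (κ * (a - b^2)^2 * (4*a - b^2)) / (a - b^2)) h)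
    (ea.mono fun a ha => (Pb a h ha).deriv)
  have Qbb := Pbb.congr_of_eventuallyEq
    (f₁ := deriv (fun b => C (κ * (z - b^2)^2 * (4*z - b^2)) / (z - b^2)))
    (eb.mono fun b hb => (Pb z b hb).deriv)
  unfold pdeLHS
  rw [Qaa.deriv, Qba.deriv, Qbb.deriv]
  simp only [Function.comp, id, Pi.pow_apply, Pi.mul_apply, Pi.add_apply, Pi.sub_apply]
  rw [ode (κ * (z - h^2)^2 * (4*z - h^2))]
  generalize D (κ * (z - h^2)^2 * (4*z - h^2)) = d
  generalize E (κ * (z - h^2)^2 * (4*z - h^2)) = e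
  push_cast
  obtain ⟨u, hu'⟩ : ∃ u, u = z - h^2 := ⟨_, rfl⟩
  obtain rfl : z = u + h^2 := by rw [hu']; ring
  simp only [add_sub_cancel_right] at hu ⊢
  field_simp
  ring

lemma series_eq (lam z h : ℂ) : (fun k : ℕ =>
      (lam/3)^(2*k) * (z - h^2)^(2*k) * (4*z - h^2)^k / ((2*k).factorial : ℂ)) =
    fun k : ℕ => ((lam/3)^2 * (z - h^2)^2 * (4*z - h^2))^k / ((2*k).factorial : ℂ) := by
  funext k
  rw [mul_pow, mul_pow, pow_mul, pow_mul]

/-- For linear potential `F(z) = λ² z`, the series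
`G(z,ẑ) = Σ_k (λ/3)^{2k} (z−ẑ²)^{2k} (4z−ẑ²)^k/(2k)!` (i.e.
`cosh((λ/3)(z−ẑ²)√(4z−ẑ²))`) converges everywhere, defines an entire function on `ℂ²`,
and `Ψ̃ = G/(z−ẑ²)` solves the linear PDE away from `z = ẑ²`. -/
theorem linear_potential_explicit_solution (lam : ℂ) :
    (∀ z zh : ℂ, Summable (fun k : ℕ =>
      (lam/3)^(2*k) * (z - zh^2)^(2*k) * (4*z - zh^2)^k / ((2*k).factorial : ℂ))) ∧
    Differentiable ℂ (fun p : ℂ × ℂ =>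
      ∑' k : ℕ, (lam/3)^(2*k) * (p.1 - p.2^2)^(2*k) * (4*p.1 - p.2^2)^k
        / ((2*k).factorial : ℂ)) ∧
    (∀ z zh : ℂ, z ≠ zh^2 →
      pdeLHS (fun a b =>
          (∑' k : ℕ, (lam/3)^(2*k) * (a - b^2)^(2*k) * (4*a - b^2)^k
            / ((2*k).factorial : ℂ)) / (a - b^2)) z zh
        = (lam^2 * z) *
            ((∑' k : ℕ, (lam/3)^(2*k) * (z - zh^2)^(2*k) * (4*z - zh^2)^k
              / ((2*k).factorial : ℂ)) / (z - zh^2))) := by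
  simp only [series_eq]
  refine ⟨fun z h => coshSq_summable _, ?_, ?_⟩
  · have h : Differentiable ℂ (fun p : ℂ × ℂ =>
        (lam/3)^2 * (p.1 - p.2^2)^2 * (4*p.1 - p.2^2)) := by fun_prop
    exact coshSq_differentiable.comp h
  · intro z h hz
    have := pde_coshSq ((lam/3)^2) z h hz
    have e : 9 * (lam/3)^2 * z = lam^2 * z := by ring
    rw [e] at this
    exact this
end

section
/- Let V be holomorphic on a neighborhood of 0 ∈ ℂ with V(0) = 0 and V′(0) = 1, and write V(q) = q·U(q) with U holomorphic, U(0) = 1. Let W be the holomorphic function near 0 with W² = U and W(0) = 1, and define g(q) = ∫₀¹ s^{1/2}·W(qs) ds (so that, formally, ∫₀^q √V = q^{3/2} g(q)). Define z(q) = q·((3/2)·g(q))^{2/3} using the principal branch (the value at q = 0 being ((3/2)·(2/3))^{2/3} = 1). Then: (i) z is holomorphic near 0 with z(0) = 0 and z′(0) = 1, hence biholomorphic from a neighborhood of 0 onto a neighborhood of 0, with holomorphic inverse q(·); (ii) the function F, defined for z ≠ 0 near 0 by F(z) = ( z / (2·V(q(z))) ) · ( z‴(q)/z′(q) − (3/2)·(z″(q)/z′(q))²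 ) evaluated at q = q(z), extends holomorphically to a neighborhood of 0; and (iii) F(0) = (3/7)·v₃ − (9/35)·v₂², where V(q) = q + v₂q² + v₃q³ + ⋯ is the Taylor expansion of V at 0. -/
open Complex Metric intervalIntegral

lemma kern_deriv (r : ℝ) (W : ℂ → ℂ) (hW : DifferentiableOn ℂ W (Metric.ball 0 r))
    (k : ℝ → ℂ) (hk : Continuous k) (q : ℂ) (hq : q ∈ Metric.ball (0 : ℂ) r) :
    HasDerivAt (fun q : ℂ => ∫ s in (0:ℝ)..1, k s * W (q * (s : ℂ)))
      (∫ s in (0:ℝ)..1, (k s * s) * deriv W (q * (s : ℂ))) q := by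
  have hq' : ‖q‖ < r := by simpa using hq
  obtain ⟨ρ, hρ1, hρ2⟩ := exists_between hq'
  have hmem : ∀ x : ℂ, ‖x‖ ≤ ρ → ∀ s ∈ Set.Icc (0:ℝ) 1, x * (s:ℂ) ∈ closedBall (0:ℂ) ρ := by
    intro x hx s hs
    have h1 : ‖(s:ℂ)‖ ≤ 1 := by
      rw [Complex.norm_real, Real.norm_eq_abs, abs_of_nonneg hs.1]; exact hs.2
    rw [mem_closedBall_zero_iff, norm_mul]
    nlinarith [norm_nonneg x, norm_nonneg (s:ℂ)]
  have hsub : closedBall (0:ℂ) ρ ⊆ ball 0 r := closedBall_subset_ball hρ2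
  have hW' : DifferentiableOn ℂ (deriv W) (ball 0 r) := hW.deriv isOpen_ball
  obtain ⟨C, hC⟩ := (isCompact_closedBall (0:ℂ) ρ).exists_bound_of_continuousOn
    (hW'.continuousOn.mono hsub)
  have hI : Set.uIcc (0:ℝ) 1 = Set.Icc 0 1 := Set.uIcc_of_le zero_le_one
  have hcont : ∀ (f : ℂ → ℂ), DifferentiableOn ℂ f (ball 0 r) → ∀ x : ℂ, ‖x‖ ≤ ρ →
      ContinuousOn (fun s : ℝ => f (x * (s:ℂ))) (Set.Icc 0 1) := by
    intro f hf x hx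
    refine hf.continuousOn.comp (by fun_prop) ?_
    intro s hs
    exact hsub (hmem x hx s hs)
  have hnb : ball (0:ℂ) ρ ∈ nhds q := isOpen_ball.mem_nhds (by simpa using hρ1)
  have hsubset : Set.uIoc (0:ℝ) 1 ⊆ Set.Icc 0 1 := by
    rw [Set.uIoc_of_le zero_le_one]; exact Set.Ioc_subset_Icc_self
  refine (intervalIntegral.hasDerivAt_integral_of_dominated_loc_of_deriv_le
    (F := fun (x : ℂ) (s : ℝ) => k s * W (x * (s:ℂ)))
    (F' := fun (x : ℂ) (s : ℝ) => (k s * s) * deriv W (x * (s:ℂ)))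
    (bound := fun s => ‖k s * s‖ * C) hnb ?_ ?_ ?_ ?_ ?_ ?_).2
  · filter_upwards [hnb] with x hx
    exact ((hk.continuousOn.mul (hcont W hW x (by simpa using (mem_ball_zero_iff.1 hx).le))).mono
      hsubset).aestronglyMeasurable measurableSet_uIoc
  · apply ContinuousOn.intervalIntegrable
    rw [hI]
    exact hk.continuousOn.mul (hcont W hW q hρ1.le)
  · refine ((ContinuousOn.mul ?_ (hcont _ hW' q hρ1.le)).mono
      hsubset).aestronglyMeasurable measurableSet_uIoc
    fun_prop
  · refine Filter.Eventually.of_forall fun s hs x hx => ?_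
    rw [norm_mul]
    gcongr
    exact hC _ (hmem x (mem_ball_zero_iff.1 hx).le s (hsubset hs))
  · apply Continuous.intervalIntegrable
    fun_prop
  · refine Filter.Eventually.of_forall fun s hs x hx => ?_
    have hx' := hsub (hmem x (mem_ball_zero_iff.1 hx).le s (hsubset hs))
    have h1 : HasDerivAt W (deriv W (x * s)) (x * s) :=
      (hW.differentiableAt (isOpen_ball.mem_nhds hx')).hasDerivAt
    have h2 : HasDerivAt (fun x : ℂ => x * (s:ℂ)) (s:ℂ) x := by
      simpa using (hasDerivAt_id x).mul_const (s:ℂ)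
    have h3 := (HasDerivAt.comp x h1 h2).const_mul (k s)
    refine h3.congr_deriv ?_
    ring

lemma int_aux (n : ℕ) : (∫ s in (0:ℝ)..1, (Real.sqrt s : ℂ) * (s:ℂ)^n) = 1 / ((n:ℂ) + 3/2) := by
  have h : ∀ s ∈ Set.uIcc (0:ℝ) 1, (Real.sqrt s : ℂ) * (s:ℂ)^n
      = ((s ^ ((n:ℝ) + 1/2) : ℝ) : ℂ) := by
    intro s hs
    rw [Set.uIcc_of_le zero_le_one] at hs
    rw [Real.sqrt_eq_rpow, Real.rpow_add_of_nonneg hs.1 (by positivity) (by positivity),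
      Real.rpow_natCast]
    push_cast; ring
  rw [intervalIntegral.integral_congr h, intervalIntegral.integral_ofReal, integral_rpow]
  · have : ((n:ℝ) + 1/2 + 1) ≠ 0 := by positivity
    rw [Real.one_rpow, Real.zero_rpow this]
    push_cast
    ring_nf
  · left
    have : (0:ℝ) ≤ n := by positivity
    linarith

lemma mul_d1 {f g : ℂ → ℂ} (hf : AnalyticAt ℂ f 0) (hg : AnalyticAt ℂ g 0) :
    iteratedDeriv 1 (fun x => f x * g x) 0 =
      iteratedDeriv 1 f 0 * g 0 + f 0 * iteratedDeriv 1 g 0 := by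
  have := iteratedDeriv_mul (n := 1) hf.contDiffAt hg.contDiffAt
  simp only [Finset.sum_range_succ, Finset.sum_range_zero] at this
  refine this.trans ?_
  simp
  ring

lemma mul_d2 {f g : ℂ → ℂ} (hf : AnalyticAt ℂ f 0) (hg : AnalyticAt ℂ g 0) :
    iteratedDeriv 2 (fun x => f x * g x) 0 =
      iteratedDeriv 2 f 0 * g 0 + 2 * iteratedDeriv 1 f 0 * iteratedDeriv 1 g 0
        + f 0 * iteratedDeriv 2 g 0 := by
  have := iteratedDeriv_mul (n := 2) hf.contDiffAt hg.contDiffAt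
  simp only [Finset.sum_range_succ, Finset.sum_range_zero] at this
  refine this.trans ?_
  simp
  ring

lemma id_it2 : iteratedDeriv 2 (fun x : ℂ => x) 0 = 0 := by
  simp [iteratedDeriv_succ]

lemma id_it3 : iteratedDeriv 3 (fun x : ℂ => x) 0 = 0 := by
  simp [iteratedDeriv_succ]

lemma id_it1 : iteratedDeriv 1 (fun x : ℂ => x) 0 = 1 := by
  simp

lemma xmul {g : ℂ → ℂ} (hg : AnalyticAt ℂ g 0) :
    iteratedDeriv 1 (fun x => x * g x) 0 = g 0 ∧
    iteratedDeriv 2 (fun x => x * g x) 0 = 2 * iteratedDeriv 1 g 0 ∧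
    iteratedDeriv 3 (fun x => x * g x) 0 = 3 * iteratedDeriv 2 g 0 := by
  refine ⟨?_, ?_, ?_⟩
  · rw [mul_d1 (f := fun x => x) analyticAt_id hg]; simp
  · rw [mul_d2 (f := fun x => x) analyticAt_id hg, id_it2, id_it1]; ring
  · have := iteratedDeriv_mul (n := 3) (analyticAt_id (𝕜 := ℂ) (z := 0)).contDiffAt hg.contDiffAt
    simp only [Finset.sum_range_succ, Finset.sum_range_zero] at this
    refine this.trans ?_
    have h2 : iteratedDeriv 2 (id : ℂ → ℂ) 0 = 0 := id_it2
    have h3 : iteratedDeriv 3 (id : ℂ → ℂ) 0 = 0 := id_it3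
    rw [h2, h3]
    simp [Nat.choose]

/-- The Langer variable `z(q) = q ((3/2) g(q))^{2/3}`, where
`g(q) = ∫₀¹ √s · W(qs) ds` and `W² = U`, `V(q) = q U(q)`, is a local biholomorphism
fixing `0` with `z'(0) = 1`; the function `F(z) = (z/(2V(q(z)))) {z,q}` extends
holomorphically through `0`, with value `(3/7)v₃ − (9/35)v₂²` at `0`. -/
theorem langer_variable_and_F (r : ℝ) (hr : 0 < r) (V U W g Z : ℂ → ℂ)
    (hV : DifferentiableOn ℂ V (Metric.ball 0 r)) (hV0 : V 0 = 0) (hV1 : deriv V 0 = 1)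
    (hU : DifferentiableOn ℂ U (Metric.ball 0 r)) (hU0 : U 0 = 1)
    (hVU : ∀ q ∈ Metric.ball (0 : ℂ) r, V q = q * U q)
    (hW : DifferentiableOn ℂ W (Metric.ball 0 r)) (hW0 : W 0 = 1)
    (hWU : ∀ q ∈ Metric.ball (0 : ℂ) r, (W q)^2 = U q)
    (hg : ∀ q ∈ Metric.ball (0 : ℂ) r,
      g q = ∫ s in (0:ℝ)..1, (Real.sqrt s : ℂ) * W (q * (s : ℂ)))
    (hZ : ∀ q ∈ Metric.ball (0 : ℂ) r, Z q = q * ((3/2) * g q) ^ ((2 : ℂ)/3)) :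
    ∃ (r₁ r₂ : ℝ) (Q : ℂ → ℂ), 0 < r₁ ∧ 0 < r₂ ∧ r₁ ≤ r ∧
      DifferentiableOn ℂ Z (Metric.ball 0 r₁) ∧ Z 0 = 0 ∧ deriv Z 0 = 1 ∧
      DifferentiableOn ℂ Q (Metric.ball 0 r₂) ∧ Q 0 = 0 ∧
      (∀ w ∈ Metric.ball (0 : ℂ) r₂, Q w ∈ Metric.ball (0 : ℂ) r₁ ∧ Z (Q w) = w) ∧
      (∀ q ∈ Metric.ball (0 : ℂ) r₁, Z q ∈ Metric.ball (0 : ℂ) r₂ → Q (Z q) = q) ∧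
      ∃ (r₃ : ℝ) (Fext : ℂ → ℂ), 0 < r₃ ∧ r₃ ≤ r₂ ∧
        DifferentiableOn ℂ Fext (Metric.ball 0 r₃) ∧
        (∀ w ∈ Metric.ball (0 : ℂ) r₃, w ≠ 0 →
          Fext w = (w / (2 * V (Q w))) *
            (deriv (deriv (deriv Z)) (Q w) / deriv Z (Q w)
              - (3/2) * (deriv (deriv Z) (Q w) / deriv Z (Q w))^2)) ∧
        Fext 0 = (3/7) * (iteratedDeriv 3 V 0 / 6) - (9/35) * (iteratedDeriv 2 V 0 / 2)^2 := by
  have hnb : ball (0:ℂ) r ∈ nhds (0:ℂ) := ball_mem_nhds _ hr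
  have hm0 : (0:ℂ) ∈ ball (0:ℂ) r := mem_ball_self hr
  have aU : AnalyticAt ℂ U 0 := hU.analyticAt hnb
  have aW : AnalyticAt ℂ W 0 := hW.analyticAt hnb
  have hW' : DifferentiableOn ℂ (deriv W) (ball 0 r) := hW.deriv isOpen_ball
  -- derivatives of g
  have hk1 : Continuous fun s : ℝ => ((Real.sqrt s : ℝ) : ℂ) := by fun_prop
  have hk2 : Continuous fun s : ℝ => ((Real.sqrt s : ℝ) : ℂ) * (s:ℂ) := by fun_prop
  have hgE : g =ᶠ[nhds 0] fun q => ∫ s in (0:ℝ)..1, (Real.sqrt s : ℂ) * W (q * (s : ℂ)) := by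
    filter_upwards [hnb] with q hq using hg q hq
  have hgd : ∀ q ∈ ball (0:ℂ) r, HasDerivAt g
      (∫ s in (0:ℝ)..1, ((Real.sqrt s : ℂ) * s) * deriv W (q * (s : ℂ))) q := by
    intro q hq
    refine (kern_deriv r W hW _ hk1 q hq).congr_of_eventuallyEq ?_
    filter_upwards [isOpen_ball.mem_nhds hq] with x hx using hg x hx
  have ag : AnalyticAt ℂ g 0 := DifferentiableOn.analyticAt (s := ball 0 r)
    (fun q hq => (hgd q hq).differentiableAt.differentiableWithinAt) hnb
  have g0 : g 0 = 2/3 := by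
    rw [hg 0 hm0]
    have := int_aux 0
    simp only [pow_zero, mul_one] at this
    simp only [zero_mul, hW0, mul_one]
    rw [this]; norm_num
  have g1 : iteratedDeriv 1 g 0 = 2/5 * iteratedDeriv 1 W 0 := by
    rw [iteratedDeriv_one, iteratedDeriv_one, (hgd 0 hm0).deriv]
    have := int_aux 1
    simp only [pow_one] at this
    simp only [zero_mul]
    rw [intervalIntegral.integral_mul_const, this]; norm_num
  have g2 : iteratedDeriv 2 g 0 = 2/7 * iteratedDeriv 2 W 0 := by
    rw [iteratedDeriv_succ (f := g), iteratedDeriv_succ (f := W), iteratedDeriv_one, iteratedDeriv_one]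
    have hE : deriv g =ᶠ[nhds 0] fun q =>
        ∫ s in (0:ℝ)..1, ((Real.sqrt s : ℂ) * s) * deriv W (q * (s : ℂ)) := by
      filter_upwards [hnb] with q hq using (hgd q hq).deriv
    rw [hE.deriv_eq, (kern_deriv r _ hW' _ hk2 0 hm0).deriv]
    have := int_aux 2
    simp only [zero_mul]
    rw [intervalIntegral.integral_mul_const]
    simp only [pow_two, ← mul_assoc] at this
    rw [this]; norm_num
  -- P and H
  obtain ⟨P, hP⟩ : ∃ P : ℂ → ℂ, P = fun q => (3/2) * g q := ⟨_, rfl⟩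
  have aP : AnalyticAt ℂ P 0 := by rw [hP]; exact analyticAt_const.mul ag
  have P0 : P 0 = 1 := by simp only [hP, g0]; norm_num
  have P1 : iteratedDeriv 1 P 0 = 3/5 * iteratedDeriv 1 W 0 := by
    rw [hP, iteratedDeriv_const_mul_field, g1]; ring
  have P2 : iteratedDeriv 2 P 0 = 3/7 * iteratedDeriv 2 W 0 := by
    rw [hP, iteratedDeriv_const_mul_field, g2]; ring
  obtain ⟨H, hH⟩ : ∃ H : ℂ → ℂ, H = fun q => (P q) ^ ((2:ℂ)/3) := ⟨_, rfl⟩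
  have aH : AnalyticAt ℂ H 0 := by
    rw [hH]; exact aP.cpow analyticAt_const (by rw [P0]; exact one_mem_slitPlane)
  have H0 : H 0 = 1 := by simp only [hH, P0, one_cpow]
  have hHP : ∀ q, H q * (H q * H q) = P q * P q := by
    intro q
    have h1 : H q ^ 3 = P q ^ 2 := by
      simp only [hH]
      rw [← Complex.cpow_nat_mul, ← Complex.cpow_natCast]
      norm_num
    linear_combination h1
  have hHPf : (fun q => H q * (H q * H q)) = fun q => P q * P q := funext hHP
  have aHH : AnalyticAt ℂ (fun q => H q * H q) 0 := aH.mul aH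
  have H1 : 3 * iteratedDeriv 1 H 0 = 2 * iteratedDeriv 1 P 0 := by
    have h := congrArg (fun f => iteratedDeriv 1 f 0) hHPf
    rw [mul_d1 aH aHH, mul_d1 aH aH, mul_d1 aP aP, H0, P0] at h
    linear_combination h
  have H2 : 6 * iteratedDeriv 1 H 0 ^ 2 + 3 * iteratedDeriv 2 H 0
      = 2 * iteratedDeriv 1 P 0 ^ 2 + 2 * iteratedDeriv 2 P 0 := by
    have h := congrArg (fun f => iteratedDeriv 2 f 0) hHPf
    rw [mul_d2 aH aHH, mul_d1 aH aH, mul_d2 aH aH, mul_d2 aP aP, H0, P0] at h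
    linear_combination h
  -- Z
  have hZH : ∀ q ∈ ball (0:ℂ) r, Z q = q * H q := by
    intro q hq; rw [hZ q hq, hH, hP]
  have hZE : Z =ᶠ[nhds 0] fun q => q * H q := by
    filter_upwards [hnb] with q hq using hZH q hq
  have aZ : AnalyticAt ℂ Z 0 := (analyticAt_id.mul aH).congr hZE.symm
  have Z0 : Z 0 = 0 := by rw [hZH 0 hm0, zero_mul]
  obtain ⟨x1, x2, x3⟩ := xmul aH
  have Z1 : deriv Z 0 = 1 := by
    rw [← iteratedDeriv_one, hZE.iteratedDeriv_eq, x1, H0]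
  have Z2 : deriv (deriv Z) 0 = 2 * iteratedDeriv 1 H 0 := by
    rw [← x2, ← hZE.iteratedDeriv_eq, iteratedDeriv_succ, iteratedDeriv_one]
  have Z3 : deriv (deriv (deriv Z)) 0 = 3 * iteratedDeriv 2 H 0 := by
    rw [← x3, ← hZE.iteratedDeriv_eq, iteratedDeriv_succ, iteratedDeriv_succ, iteratedDeriv_one]
  -- V
  have hVE : V =ᶠ[nhds 0] fun q => q * U q := by
    filter_upwards [hnb] with q hq using hVU q hq
  have hUE : U =ᶠ[nhds 0] fun q => W q * W q := by
    filter_upwards [hnb] with q hq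
    rw [← hWU q hq, sq]
  obtain ⟨-, y2, y3⟩ := xmul aU
  have V2 : iteratedDeriv 2 V 0 = 4 * iteratedDeriv 1 W 0 := by
    rw [hVE.iteratedDeriv_eq, y2, hUE.iteratedDeriv_eq, mul_d1 aW aW, hW0]; ring
  have V3 : iteratedDeriv 3 V 0 = 6 * iteratedDeriv 1 W 0 ^ 2 + 6 * iteratedDeriv 2 W 0 := by
    rw [hVE.iteratedDeriv_eq, y3, hUE.iteratedDeriv_eq, mul_d2 aW aW, hW0]; ring
  -- the inverse
  have hZne : deriv Z 0 ≠ 0 := by rw [Z1]; exact one_ne_zero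
  obtain ⟨Q, hQ⟩ : ∃ Q : ℂ → ℂ, Q = aZ.hasStrictDerivAt.localInverse _ _ _ hZne := ⟨_, rfl⟩
  have aQ : AnalyticAt ℂ Q 0 := by
    have := aZ.analyticAt_localInverse hZne
    rwa [Z0, ← hQ] at this
  have Q0 : Q 0 = 0 := by
    have : Q (Z 0) = 0 := by rw [hQ]; exact HasStrictFDerivAt.localInverse_apply_image ..
    rwa [Z0] at this
  have hleft : ∀ᶠ q in nhds (0:ℂ), Q (Z q) = q := by
    rw [hQ]; exact HasStrictDerivAt.eventually_left_inverse ..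
  have hright : ∀ᶠ w in nhds (0:ℂ), Z (Q w) = w := by
    have : ∀ᶠ w in nhds (Z 0), Z (Q w) = w := by
      rw [hQ]; exact HasStrictDerivAt.eventually_right_inverse ..
    rwa [Z0] at this
  obtain ⟨r₁, hr1, h1⟩ := Metric.eventually_nhds_iff_ball.1
    ((hleft.and aZ.eventually_analyticAt).and hnb)
  have hQt : ∀ᶠ w in nhds (0:ℂ), Q w ∈ ball (0:ℂ) (min r₁ r) := by
    have := aQ.continuousAt
    rw [ContinuousAt, Q0] at this
    exact this (ball_mem_nhds _ (lt_min hr1 hr))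
  obtain ⟨r₂, hr2, h2⟩ := Metric.eventually_nhds_iff_ball.1
    ((hright.and aQ.eventually_analyticAt).and hQt)
  have hs1 : ball (0:ℂ) (min r₁ r) ⊆ ball 0 r₁ := ball_subset_ball (min_le_left _ _)
  have hs2 : ball (0:ℂ) (min r₁ r) ⊆ ball 0 r := ball_subset_ball (min_le_right _ _)
  -- F
  obtain ⟨G, hG⟩ : ∃ G : ℂ → ℂ, G = fun q => (H q / (2 * U q)) *
            (deriv (deriv (deriv Z)) q / deriv Z q
              - (3/2) * (deriv (deriv Z) q / deriv Z q)^2) := ⟨_, rfl⟩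
  have aG : AnalyticAt ℂ G (Q 0) := by
    rw [Q0, hG]
    refine (aH.div (analyticAt_const.mul aU) ?_).mul
      ((aZ.deriv.deriv.deriv.div aZ.deriv hZne).sub
        (analyticAt_const.mul ((aZ.deriv.deriv.div aZ.deriv hZne).pow 2)))
    simp [hU0]
  have aF : AnalyticAt ℂ (fun w => G (Q w)) 0 := aG.comp aQ
  obtain ⟨r₃, hr3, h3⟩ := Metric.eventually_nhds_iff_ball.1 aF.eventually_analyticAt
  refine ⟨min r₁ r, r₂, Q, lt_min hr1 hr, hr2, min_le_right _ _, ?_, Z0, Z1, ?_, Q0, ?_, ?_,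
    min r₂ r₃, fun w => G (Q w), lt_min hr2 hr3, min_le_left _ _, ?_, ?_, ?_⟩
  · intro q hq
    exact (h1 q (hs1 hq)).1.2.differentiableAt.differentiableWithinAt
  · intro w hw
    exact (h2 w hw).1.2.differentiableAt.differentiableWithinAt
  · intro w hw
    exact ⟨(h2 w hw).2, (h2 w hw).1.1⟩
  · intro q hq _
    exact (h1 q (hs1 hq)).1.1
  · intro w hw
    exact (h3 w (ball_subset_ball (min_le_right _ _) hw)).differentiableAt.differentiableWithinAt
  · intro w hw hw0
    have hw2 := h2 w (ball_subset_ball (min_le_left _ _) hw)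
    have hq := hs2 hw2.2
    have e1 : w = Q w * H (Q w) := by rw [← hZH _ hq, hw2.1.1]
    have hQne : Q w ≠ 0 := by
      intro h
      rw [h, zero_mul] at e1
      exact hw0 e1
    have e2 : w / (2 * V (Q w)) = H (Q w) / (2 * U (Q w)) := by
      rw [hVU _ hq]
      conv_lhs => rw [show w / (2 * (Q w * U (Q w)))
        = (Q w * H (Q w)) / (Q w * (2 * U (Q w))) from by rw [← e1]; ring_nf]
      rw [mul_div_mul_left _ _ hQne]
    rw [e2, hG]
  · simp only [hG, Q0, H0, hU0, Z1, Z2, Z3, V2, V3]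
    have e1 : iteratedDeriv 1 H 0 = 2/5 * iteratedDeriv 1 W 0 := by
      linear_combination (1/3) * H1 + (2/3) * P1
    rw [e1, P1, P2] at H2
    rw [e1]
    linear_combination (1/2) * H2
end

section
/- Let V be holomorphic near 0 with V(0) = 0, V′(0) = 1, let z(q) be the Langer variable (holomorphic near 0, z(0) = 0, z′(0) = 1, satisfying z(q)·z′(q)² = V(q)), let q(·) be its local inverse, and let F(z) = (z/(2V(q(z))))·( z‴/z′ − (3/2)(z″/z′)² )|_{q=q(z)} (extended holomorphically through 0). Fix ε ∈ ℂ \ {0}. If Φ is holomorphic on a neighborhood of 0 and satisfies Φ″(z) − (z/ε²)·Φ(z) = F(z)·Φ(z) there, then the function Y(q) := (z′(q))^{-1/2}·Φ(z(q)), defined near q = 0 with the holomorphic branch of (z′)^{-1/2} equal to 1 at q = 0, satisfies ε²·Y″(q) = V(q)·Y(q) on a neighborhood of 0. -/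
open Complex Metric

/-- The Liouville–Green (Langer) transformation `Y(q) = (z'(q))^{-1/2} Φ(z(q))` carries
a holomorphic solution `Φ` of the canonical equation `Φ'' − (z/ε²)Φ = F(z)Φ` into a
solution of the Schrödinger equation `ε² Y'' = V(q) Y` near the simple turning point. -/
theorem liouville_green_transformation (r : ℝ) (hr : 0 < r)
    (V Z Q F ρ Φ : ℂ → ℂ) (ε : ℂ) (hε : ε ≠ 0)
    (hV : DifferentiableOn ℂ V (Metric.ball 0 r)) (hV0 : V 0 = 0) (hV1 : deriv V 0 = 1)
    (hZ : DifferentiableOn ℂ Z (Metric.ball 0 r)) (hZ0 : Z 0 = 0) (hZ1 : deriv Z 0 = 1)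
    (hZV : ∀ q ∈ Metric.ball (0 : ℂ) r, Z q * (deriv Z q)^2 = V q)
    (hQ : DifferentiableOn ℂ Q (Metric.ball 0 r)) (hQ0 : Q 0 = 0)
    (hQZ : ∀ q ∈ Metric.ball (0 : ℂ) r, Z q ∈ Metric.ball (0 : ℂ) r → Q (Z q) = q)
    (hZQ : ∀ w ∈ Metric.ball (0 : ℂ) r, Q w ∈ Metric.ball (0 : ℂ) r → Z (Q w) = w)
    (hF : DifferentiableOn ℂ F (Metric.ball 0 r))
    (hFeq : ∀ w ∈ Metric.ball (0 : ℂ) r, w ≠ 0 →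
      F w = (w / (2 * V (Q w))) *
        (deriv (deriv (deriv Z)) (Q w) / deriv Z (Q w)
          - (3/2) * (deriv (deriv Z) (Q w) / deriv Z (Q w))^2))
    (hρ : DifferentiableOn ℂ ρ (Metric.ball 0 r)) (hρ0 : ρ 0 = 1)
    (hρZ : ∀ q ∈ Metric.ball (0 : ℂ) r, (ρ q)^2 * deriv Z q = 1)
    (hΦ : DifferentiableOn ℂ Φ (Metric.ball 0 r))
    (hΦeq : ∀ z ∈ Metric.ball (0 : ℂ) r,
      deriv (deriv Φ) z - (z / ε^2) * Φ z = F z * Φ z) :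
    ∃ δ : ℝ, 0 < δ ∧ ∀ q ∈ Metric.ball (0 : ℂ) δ,
      ε^2 * deriv (deriv (fun w => ρ w * Φ (Z w))) q = V q * (ρ q * Φ (Z q)) := by
  have hc : ContinuousAt Z 0 := (hZ.differentiableAt (ball_mem_nhds 0 hr)).continuousAt
  have hmem : Z ⁻¹' ball 0 r ∈ nhds (0 : ℂ) :=
    hc.preimage_mem_nhds (by rw [hZ0]; exact ball_mem_nhds 0 hr)
  obtain ⟨δ₀, hδ₀, hsub⟩ := Metric.mem_nhds_iff.1 hmem
  have hO : IsOpen (ball (0 : ℂ) r) := isOpen_ball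
  have key : ∀ f : ℂ → ℂ, DifferentiableOn ℂ f (ball 0 r) → ∀ x ∈ ball (0 : ℂ) r,
      HasDerivAt f (deriv f x) x := fun f hf x hx =>
    (hf.differentiableAt (hO.mem_nhds hx)).hasDerivAt
  have hZd := hZ.deriv hO
  have hZdd := hZd.deriv hO
  have hρd := hρ.deriv hO
  have hΦd := hΦ.deriv hO
  set δ := min δ₀ r with hδ
  have hδpos : 0 < δ := lt_min hδ₀ hr
  have hin : ∀ q ∈ ball (0 : ℂ) δ, q ∈ ball (0 : ℂ) r := fun q hq =>
    ball_subset_ball (min_le_right _ _) hq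
  have hZin : ∀ q ∈ ball (0 : ℂ) δ, Z q ∈ ball (0 : ℂ) r := fun q hq =>
    hsub (ball_subset_ball (min_le_left _ _) hq)
  have hU : IsOpen (ball (0 : ℂ) δ) := isOpen_ball
  -- derivatives of the transformed function
  have hY1 : ∀ q ∈ ball (0 : ℂ) δ, HasDerivAt (fun w => ρ w * Φ (Z w))
      (deriv ρ q * Φ (Z q) + ρ q * (deriv Φ (Z q) * deriv Z q)) q := fun q hq =>
    (key ρ hρ q (hin q hq)).mul
      ((key Φ hΦ (Z q) (hZin q hq)).comp q (key Z hZ q (hin q hq)))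
  have hY2 : ∀ q ∈ ball (0 : ℂ) δ, deriv (deriv (fun w => ρ w * Φ (Z w))) q =
      (deriv (deriv ρ) q * Φ (Z q) + deriv ρ q * (deriv Φ (Z q) * deriv Z q)) +
      (deriv ρ q * (deriv Φ (Z q) * deriv Z q) + ρ q *
        (deriv (deriv Φ) (Z q) * deriv Z q * deriv Z q
          + deriv Φ (Z q) * deriv (deriv Z) q)) := by
    intro q hq
    have he : deriv (fun w => ρ w * Φ (Z w)) =ᶠ[nhds q]
        fun q => deriv ρ q * Φ (Z q) + ρ q * (deriv Φ (Z q) * deriv Z q) := by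
      filter_upwards [hU.mem_nhds hq] with x hx using (hY1 x hx).deriv
    rw [he.deriv_eq]
    have hz := key Z hZ q (hin q hq)
    have h1 := (key _ hρd q (hin q hq)).mul ((key Φ hΦ (Z q) (hZin q hq)).comp q hz)
    have h2 := (key ρ hρ q (hin q hq)).mul
      (((key _ hΦd (Z q) (hZin q hq)).comp q hz).mul (key _ hZd q (hin q hq)))
    exact (h1.add h2).deriv
  -- derivatives of the relation `ρ² Z' = 1`
  have hR1 : ∀ q ∈ ball (0 : ℂ) r,
      2 * ρ q * deriv ρ q * deriv Z q + ρ q ^ 2 * deriv (deriv Z) q = 0 := by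
    intro q hq
    have h := (((key ρ hρ q hq).pow 2).mul (key _ hZd q hq))
    have he : (fun x => ρ x ^ 2 * deriv Z x) =ᶠ[nhds q] fun _ => (1 : ℂ) := by
      filter_upwards [hO.mem_nhds hq] with x hx using hρZ x hx
    have h' := (h.congr_of_eventuallyEq he.symm).unique (hasDerivAt_const q (1 : ℂ))
    simpa using h'
  have hR2 : ∀ q ∈ ball (0 : ℂ) r,
      2 * deriv ρ q ^ 2 * deriv Z q + 2 * ρ q * deriv (deriv ρ) q * deriv Z q
        + 4 * ρ q * deriv ρ q * deriv (deriv Z) q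
        + ρ q ^ 2 * deriv (deriv (deriv Z)) q = 0 := by
    intro q hq
    have h := ((((key ρ hρ q hq).const_mul 2).mul (key _ hρd q hq)).mul (key _ hZd q hq)).add
      (((key ρ hρ q hq).pow 2).mul (key _ hZdd q hq))
    have he : (fun q => 2 * ρ q * deriv ρ q * deriv Z q + ρ q ^ 2 * deriv (deriv Z) q)
        =ᶠ[nhds q] fun _ => (0 : ℂ) := by
      filter_upwards [hO.mem_nhds hq] with x hx using hR1 x hx
    have h' := (h.congr_of_eventuallyEq he.symm).unique (hasDerivAt_const q (0 : ℂ))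
    simp at h'
    linear_combination h'
  have main : ∀ q ∈ ball (0 : ℂ) δ, q ≠ 0 →
      ε^2 * deriv (deriv (fun w => ρ w * Φ (Z w))) q = V q * (ρ q * Φ (Z q)) := by
    intro q hq hq0
    have hqr := hin q hq
    have hzr := hZin q hq
    have hQq := hQZ q hqr hzr
    have hz0 : Z q ≠ 0 := by
      intro h0
      rw [h0, hQ0] at hQq
      exact hq0 hQq.symm
    have hf := hFeq (Z q) hzr hz0
    rw [hQq, ← hZV q hqr] at hf
    have hφ := hΦeq (Z q) hzr
    have e1 := hR1 q hqr
    have e2 := hR2 q hqr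
    have e0 := hρZ q hqr
    rw [hY2 q hq, ← hZV q hqr]
    generalize deriv (deriv (deriv Z)) q = c at *
    generalize deriv (deriv Z) q = b at *
    generalize deriv Z q = a at *
    generalize deriv (deriv ρ) q = p2 at *
    generalize deriv ρ q = p1 at *
    generalize ρ q = p at *
    generalize deriv (deriv Φ) (Z q) = f2 at *
    generalize deriv Φ (Z q) = f1 at *
    generalize Φ (Z q) = f at *
    generalize F (Z q) = G at *
    generalize Z q = z at *
    have hp : p ≠ 0 := by rintro rfl; simp at e0
    have ha : a ≠ 0 := by rintro rfl; simp at e0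
    have hb : b = -2 * p1 * a / p := by
      field_simp
      apply mul_left_cancel₀ hp
      linear_combination e1
    have hcc : c = -(2 * p1 ^ 2 * a + 2 * p * p2 * a + 4 * p * p1 * b) / p ^ 2 := by
      field_simp
      linear_combination e2
    have hG : p2 + p * a ^ 2 * G = 0 := by
      rw [hf, hcc, hb]
      field_simp
      ring
    have hf2 : f2 = (z / ε ^ 2) * f + G * f := by linear_combination hφ
    have h1 : 2 * p1 * a + p * b = 0 := by
      rw [hb]; field_simp; ring
    have h3 : ε ^ 2 * (z / ε ^ 2) = z := by field_simp
    rw [hf2]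
    linear_combination ε ^ 2 * f * hG + ε ^ 2 * f1 * h1 + p * a ^ 2 * f * h3
  refine ⟨δ, hδpos, fun q hq => ?_⟩
  by_cases hq0 : q = 0
  swap
  · exact main q hq hq0
  subst hq0
  have hYd : DifferentiableOn ℂ (fun w => ρ w * Φ (Z w)) (ball 0 δ) := fun x hx =>
    (hY1 x hx).differentiableAt.differentiableWithinAt
  have hn := hU.mem_nhds hq
  have c1 : ContinuousAt (fun q => ε^2 * deriv (deriv (fun w => ρ w * Φ (Z w))) q) 0 :=
    ((((hYd.deriv hU).deriv hU).differentiableAt hn).const_mul _).continuousAt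
  have c2 : ContinuousAt (fun q => V q * (ρ q * Φ (Z q))) 0 :=
    ((hV.differentiableAt (hO.mem_nhds (hin 0 hq))).mul
      (hYd.differentiableAt hn)).continuousAt
  have t1 := c1.tendsto.mono_left (nhdsWithin_le_nhds (s := {0}ᶜ))
  have t2 := c2.tendsto.mono_left (nhdsWithin_le_nhds (s := {0}ᶜ))
  refine tendsto_nhds_unique (t1.congr' ?_) t2
  filter_upwards [self_mem_nhdsWithin, mem_nhdsWithin_of_mem_nhds hn] with x hx hx'
  exact main x hx' hx
end
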